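/- arXiv:2207.13291 — 2 statements merged into one kernel-verified Lean document; each statement's English description precedes it below -/
import Mathlib

section
/- Let I be a finite linear order with exactly k ≥ 1 elements, given by an order isomorphism e : Fin k ≃o I, let v₀ : V, and let f : V → R be a function into a commutative additive monoid R. Then the evaluation of the constant stream ↑v₀ is the constant function: for every x : I, ⟦↑v₀⟧_f(x) = f(v₀). -/
/-- An indexed stream of type `I → V`: a state space `σ`, a current state `q`,
an index function `ι`, a value function `v`, a ready flag, and a successor `δ`. -/
structure IStream (σ : Type*) (I : Type*) (V : Type*) where
  q : σ
  ι : σ → I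
  v : σ → V
  ready : σ → Bool
  δ : σ → σ

namespace IStream

variable {σ σ₁ σ₂ : Type*} {I : Type*} {V : Type*}

/-- The set of states reachable from the current state. -/
def reachSet (s : IStream σ I V) : Set σ := {r | ∃ k : ℕ, r = s.δ^[k] s.q}

/-- A stream is finite if a terminal state is reachable from its current state. -/
def Finite (s : IStream σ I V) : Prop := ∃ t ∈ s.reachSet, s.δ t = t

/-- Finite, with the reachable terminal state not ready. -/
def FiniteNR (s : IStream σ I V) : Prop :=
  ∃ t ∈ s.reachSet, s.δ t = t ∧ s.ready t = false

/-- Monotonic: the index is nondecreasing along every reachable transition. -/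
def Monotonic [Preorder I] (s : IStream σ I V) : Prop :=
  ∀ r ∈ s.reachSet, s.ι r ≤ s.ι (s.δ r)

/-- Reduced: distinct reachable ready states (one reachable from the other)
have distinct indices. -/
def Reduced (s : IStream σ I V) : Prop :=
  ∀ r s', r ∈ s.reachSet → (∃ k : ℕ, s' = s.δ^[k] r) →
    s.ready r = true → s.ready s' = true → s.ι r = s.ι s' → r = s'

/-- A simple stream: finite (with non-ready terminal state), monotonic, reduced. -/
def IsSimple [Preorder I] (s : IStream σ I V) : Prop :=
  s.FiniteNR ∧ s.Monotonic ∧ s.Reduced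

/-- The stream restarted at the successor of its current state. -/
def step (s : IStream σ I V) : IStream σ I V := { s with q := s.δ s.q }

open Classical in
/-- Evaluation of a stream: the sum, over reachable states `r`, of the function
supported at `ι r` with value `f (v r)` when `ready r`, and `0` otherwise. -/
noncomputable def eval {R : Type*} [AddCommMonoid R] (s : IStream σ I V) (f : V → R) : I → R :=
  fun y => ∑ᶠ r ∈ s.reachSet,
    if s.ready r = true then (if y = s.ι r then f (s.v r) else 0) else 0

/-- The product stream. -/
def mul [LinearOrder I] [Mul V] (a : IStream σ₁ I V) (b : IStream σ₂ I V) :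
    IStream (σ₁ × σ₂) I V where
  q := (a.q, b.q)
  ι p := max (a.ι p.1) (b.ι p.2)
  v p := a.v p.1 * b.v p.2
  ready p := a.ready p.1 && b.ready p.2 && decide (a.ι p.1 = b.ι p.2)
  δ p := if a.ι p.1 < b.ι p.2 ∨ (a.ι p.1 = b.ι p.2 ∧ a.ready p.1 = false)
         then (a.δ p.1, p.2) else (p.1, b.δ p.2)

/-- The sum stream. -/
def add [LinearOrder I] [Add V] [Zero V] (a : IStream σ₁ I V) (b : IStream σ₂ I V) :
    IStream (σ₁ × σ₂) I V where
  q := (a.q, b.q)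
  ι p := min (a.ι p.1) (b.ι p.2)
  v p := (if a.ι p.1 ≤ b.ι p.2 then a.v p.1 else 0) +
         (if b.ι p.2 ≤ a.ι p.1 then b.v p.2 else 0)
  ready p := a.ready p.1 || b.ready p.2
  δ p := if a.ι p.1 < b.ι p.2 ∨ (a.ι p.1 = b.ι p.2 ∧ a.ready p.1 = false ∧ b.ready p.2 = true)
         then (a.δ p.1, p.2)
         else if b.ι p.2 < a.ι p.1 ∨ (a.ι p.1 = b.ι p.2 ∧ b.ready p.2 = false ∧ a.ready p.1 = true)
         then (p.1, b.δ p.2)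
         else (a.δ p.1, b.δ p.2)

end IStream

/-- The constant (replication) stream `↑v₀` over a finite linear order `I` with
exactly `k ≥ 1` elements given by an order isomorphism `e : Fin k ≃o I`. -/
def constStream {I V : Type*} [LinearOrder I] {k : ℕ} (hk : 1 ≤ k)
    (e : Fin k ≃o I) (v₀ : V) : IStream (Fin (k + 1)) I V where
  q := 0
  ι r := e ⟨min r.val (k - 1), by omega⟩
  v _ := v₀
  ready r := decide (r.val < k)
  δ r := ⟨min (r.val + 1) k, by omega⟩

theorem constStream_iterate_val {I V : Type*} [LinearOrder I] {k : ℕ} (hk : 1 ≤ k)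
    (e : Fin k ≃o I) (v₀ : V) (n : ℕ) :
    ((constStream hk e v₀).δ^[n] (constStream hk e v₀).q).val = min n k := by
  induction n with
  | zero => simp [constStream]
  | succ n ih =>
    rw [Function.iterate_succ_apply']
    change min (Fin.val _ + 1) k = _
    rw [ih]
    omega

theorem constStream_reachSet {I V : Type*} [LinearOrder I] {k : ℕ} (hk : 1 ≤ k)
    (e : Fin k ≃o I) (v₀ : V) : (constStream hk e v₀).reachSet = Set.univ := by
  refine Set.eq_univ_of_forall fun r => ⟨r.val, Fin.ext ?_⟩
  rw [constStream_iterate_val]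
  omega

/-- the evaluation of the constant stream is the constant function
with value `f v₀`. -/
theorem constStream_eval {I V R : Type*} [LinearOrder I] [AddCommMonoid R]
    {k : ℕ} (hk : 1 ≤ k) (e : Fin k ≃o I) (v₀ : V) (f : V → R) :
    ∀ x : I, (constStream hk e v₀).eval f x = f v₀ := by
  intro x
  have hx := (e.symm x).isLt
  rw [IStream.eval, constStream_reachSet]
  simp only [Set.mem_univ, finsum_true]
  rw [finsum_eq_single _ (e.symm x).castSucc]
  · have h : (⟨min (e.symm x).val (k - 1), by omega⟩ : Fin k) = e.symm x :=
      Fin.ext (by simp only; omega)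
    simp [constStream, h]
  · intro r hr
    by_cases hrk : r.val < k
    · have hne : x ≠ e ⟨min r.val (k - 1), by omega⟩ := by
        intro h
        apply hr
        ext
        simp only [h, OrderIso.symm_apply_apply, Fin.val_castSucc]
        omega
      simp [constStream, hne]
    · simp [constStream, hrk]
end

section
/- Let a and b be simple indexed streams of type I → V, where V carries a multiplication, let R be a (not necessarily commutative) semiring, and let f : V → R satisfy f(x·y) = f(x)·f(y) for all x, y : V. Then the evaluation of the product stream equals the pointwise product of the evaluations: for every x : I, ⟦a·b⟧_f(x) = ⟦a⟧_f(x) · ⟦b⟧_f(x). -/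
namespace IStream

theorem q_mem_reachSet {σ I V : Type*} (s : IStream σ I V) : s.q ∈ s.reachSet := ⟨0, rfl⟩

theorem δ_mem_reachSet {σ I V : Type*} {s : IStream σ I V} {r : σ} (h : r ∈ s.reachSet) :
    s.δ r ∈ s.reachSet := by
  obtain ⟨k, rfl⟩ := h
  exact ⟨k + 1, (Function.iterate_succ_apply' _ _ _).symm⟩

theorem iterate_mem_reachSet {σ I V : Type*} {s : IStream σ I V} {r : σ} (h : r ∈ s.reachSet)
    (k : ℕ) : s.δ^[k] r ∈ s.reachSet := by
  induction k with
  | zero => exact h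
  | succ k ih => rw [Function.iterate_succ_apply']; exact δ_mem_reachSet ih

theorem Monotonic.le_iterate {σ I V : Type*} [Preorder I] {s : IStream σ I V}
    (hs : s.Monotonic) {r : σ} (h : r ∈ s.reachSet) (k : ℕ) : s.ι r ≤ s.ι (s.δ^[k] r) := by
  induction k with
  | zero => exact le_rfl
  | succ k ih =>
    rw [Function.iterate_succ_apply']
    exact ih.trans (hs _ (iterate_mem_reachSet h k))

/-- In a reduced stream, a reachable ready state is determined by its index. -/
theorem Reduced.eq_of_ready {σ I V : Type*} {s : IStream σ I V} (hs : s.Reduced) {r t : σ}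
    (hr : r ∈ s.reachSet) (ht : t ∈ s.reachSet) (hr' : s.ready r = true)
    (ht' : s.ready t = true) (h : s.ι r = s.ι t) : r = t := by
  obtain ⟨m, rfl⟩ := id hr
  obtain ⟨n, rfl⟩ := id ht
  rcases le_total m n with hmn | hmn
  · obtain ⟨k, rfl⟩ := Nat.exists_eq_add_of_le' hmn
    exact hs _ _ hr ⟨k, Function.iterate_add_apply _ _ _ _⟩ hr' ht' h
  · obtain ⟨k, rfl⟩ := Nat.exists_eq_add_of_le' hmn
    exact (hs _ _ ht ⟨k, Function.iterate_add_apply _ _ _ _⟩ ht' hr' h.symm).symm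

theorem eval_eq_zero {σ I V R : Type*} [AddCommMonoid R] {s : IStream σ I V} (f : V → R) {x : I}
    (h : ∀ r ∈ s.reachSet, s.ready r = true → s.ι r ≠ x) : s.eval f x = 0 := by
  refine finsum_mem_eq_zero_of_forall_eq_zero fun r hr => ?_
  split_ifs with h₁ h₂
  · exact absurd h₂.symm (h r hr h₁)
  · rfl
  · rfl

theorem Reduced.eval_eq {σ I V R : Type*} [AddCommMonoid R] {s : IStream σ I V}
    (hs : s.Reduced) (f : V → R) {r : σ} (hr : r ∈ s.reachSet) (hr' : s.ready r = true) :
    s.eval f (s.ι r) = f (s.v r) := by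
  unfold eval
  rw [finsum_eq_single _ r]
  · simp [hr, hr']
  · intro t htr
    by_cases ht : t ∈ s.reachSet
    · by_cases ht' : s.ready t = true
      · have hne : s.ι r ≠ s.ι t := fun h => htr (hs.eq_of_ready ht hr ht' hr' h.symm)
        simp [hne]
      · simp [ht']
    · simp [ht]

section Mul

variable {σ₁ σ₂ I V : Type*} [LinearOrder I] [Mul V] {a : IStream σ₁ I V} {b : IStream σ₂ I V}

theorem mul_ready_iff {p : σ₁ × σ₂} : (a.mul b).ready p = true ↔
    a.ready p.1 = true ∧ b.ready p.2 = true ∧ a.ι p.1 = b.ι p.2 := by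
  simp [mul, and_assoc]

theorem mem_reachSet_of_mem_mul {p : σ₁ × σ₂} (h : p ∈ (a.mul b).reachSet) :
    p.1 ∈ a.reachSet ∧ p.2 ∈ b.reachSet := by
  obtain ⟨k, rfl⟩ := h
  induction k with
  | zero => exact ⟨q_mem_reachSet a, q_mem_reachSet b⟩
  | succ k ih =>
    rw [Function.iterate_succ_apply']
    generalize (a.mul b).δ^[k] (a.mul b).q = p at ih ⊢
    simp only [mul]
    split_ifs
    · exact ⟨δ_mem_reachSet ih.1, ih.2⟩
    · exact ⟨ih.1, δ_mem_reachSet ih.2⟩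

/-- The product stream does not skip a pair of ready states with equal indices that lies ahead
of a state it reaches. -/
theorem iterate_mem_mul_reachSet (ha : a.Monotonic) (ha' : a.Reduced) (hb : b.Monotonic)
    (m n : ℕ) {r : σ₁} {s : σ₂} (hp : (r, s) ∈ (a.mul b).reachSet)
    (hr : a.ready (a.δ^[m] r) = true) (h : a.ι (a.δ^[m] r) = b.ι (b.δ^[n] s)) :
    (a.δ^[m] r, b.δ^[n] s) ∈ (a.mul b).reachSet := by
  obtain ⟨hra, hsb⟩ := mem_reachSet_of_mem_mul hp
  have hr_le := ha.le_iterate hra m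
  have hs_le := hb.le_iterate hsb n
  have hδ := δ_mem_reachSet hp
  by_cases hc : a.ι r < b.ι s ∨ (a.ι r = b.ι s ∧ a.ready r = false)
  · have hδ_eq : (a.mul b).δ (r, s) = (a.δ r, s) := if_pos hc
    rw [hδ_eq] at hδ
    cases m with
    | zero =>
      simp only [Function.iterate_zero, id_eq] at hr h
      rcases hc with hc | ⟨-, hc⟩
      · exact absurd (hc.trans_le hs_le) h.not_lt
      · simp [hr] at hc
    | succ m => exact iterate_mem_mul_reachSet ha ha' hb m n hδ hr h
  · have hδ_eq : (a.mul b).δ (r, s) = (r, b.δ s) := if_neg hc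
    rw [hδ_eq] at hδ
    cases n with
    | zero =>
      simp only [Function.iterate_zero, id_eq] at h ⊢
      obtain ⟨hlt, hready⟩ := not_or.mp hc
      have heq : a.ι r = b.ι s := le_antisymm (hr_le.trans h.le) (not_lt.mp hlt)
      have hr₀ : a.ready r = true := by simpa [heq] using hready
      rwa [← ha' _ _ hra ⟨m, rfl⟩ hr₀ hr (heq.trans h.symm)]
    | succ n => exact iterate_mem_mul_reachSet ha ha' hb m n hδ hr h
termination_by m + n

theorem mk_mem_mul_reachSet (ha : a.Monotonic) (ha' : a.Reduced) (hb : b.Monotonic)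
    {r : σ₁} {s : σ₂} (hr : r ∈ a.reachSet) (hs : s ∈ b.reachSet) (hr' : a.ready r = true)
    (h : a.ι r = b.ι s) : (r, s) ∈ (a.mul b).reachSet := by
  obtain ⟨m, rfl⟩ := hr
  obtain ⟨n, rfl⟩ := hs
  exact iterate_mem_mul_reachSet ha ha' hb m n (q_mem_reachSet (a.mul b)) hr' h

theorem mul_ι_of_ready {p : σ₁ × σ₂} (h : (a.mul b).ready p = true) :
    (a.mul b).ι p = a.ι p.1 ∧ (a.mul b).ι p = b.ι p.2 := by
  have := (mul_ready_iff.mp h).2.2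
  simp [mul, this]

theorem Reduced.mul (ha : a.Reduced) (hb : b.Reduced) : (a.mul b).Reduced := by
  rintro p _ hp ⟨k, rfl⟩ hp' ht' h
  have ht := iterate_mem_reachSet hp k
  generalize (a.mul b).δ^[k] p = t at *
  obtain ⟨hpa, hpb⟩ := mem_reachSet_of_mem_mul hp
  obtain ⟨hta, htb⟩ := mem_reachSet_of_mem_mul ht
  obtain ⟨hpa', hpb', -⟩ := mul_ready_iff.mp hp'
  obtain ⟨hta', htb', -⟩ := mul_ready_iff.mp ht'
  obtain ⟨hp₁, hp₂⟩ := mul_ι_of_ready hp'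
  obtain ⟨ht₁, ht₂⟩ := mul_ι_of_ready ht'
  exact Prod.ext (ha.eq_of_ready hpa hta hpa' hta' (hp₁.symm.trans (h.trans ht₁)))
    (hb.eq_of_ready hpb htb hpb' htb' (hp₂.symm.trans (h.trans ht₂)))

end Mul

end IStream

/-- evaluation of the product stream is the pointwise product of
the evaluations, for a multiplicative value map into a semiring. -/
theorem mul_eval {σ₁ σ₂ I V R : Type*} [LinearOrder I] [Mul V] [Semiring R]
    (a : IStream σ₁ I V) (b : IStream σ₂ I V)
    (ha : a.IsSimple) (hb : b.IsSimple)
    (f : V → R) (hf : ∀ x y : V, f (x * y) = f x * f y) :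
    ∀ x : I, (a.mul b).eval f x = a.eval f x * b.eval f x := by
  intro x
  obtain ⟨-, ham, har⟩ := ha
  obtain ⟨-, hbm, hbr⟩ := hb
  by_cases hA : ∃ r ∈ a.reachSet, a.ready r = true ∧ a.ι r = x
  · obtain ⟨r, hr, hr', rfl⟩ := hA
    by_cases hB : ∃ s ∈ b.reachSet, b.ready s = true ∧ b.ι s = a.ι r
    · obtain ⟨s, hs, hs', h⟩ := hB
      have hready : (a.mul b).ready (r, s) = true :=
        IStream.mul_ready_iff.mpr ⟨hr', hs', h.symm⟩
      have hmul := (har.mul hbr).eval_eq f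
        (IStream.mk_mem_mul_reachSet ham har hbm hr hs hr' h.symm) hready
      rw [(IStream.mul_ι_of_ready hready).1] at hmul
      rw [hmul, har.eval_eq f hr hr', ← h, hbr.eval_eq f hs hs']
      exact hf _ _
    · rw [IStream.eval_eq_zero (s := b) f fun s hs hs' h => hB ⟨s, hs, hs', h⟩, mul_zero]
      refine IStream.eval_eq_zero f fun p hp hp' h => hB ⟨p.2, ?_⟩
      exact ⟨(IStream.mem_reachSet_of_mem_mul hp).2, (IStream.mul_ready_iff.mp hp').2.1,
        (IStream.mul_ι_of_ready hp').2.symm.trans h⟩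
  · rw [IStream.eval_eq_zero (s := a) f fun r hr hr' h => hA ⟨r, hr, hr', h⟩, zero_mul]
    refine IStream.eval_eq_zero f fun p hp hp' h => hA ⟨p.1, ?_⟩
    exact ⟨(IStream.mem_reachSet_of_mem_mul hp).1, (IStream.mul_ready_iff.mp hp').1,
      (IStream.mul_ι_of_ready hp').1.symm.trans h⟩
end
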